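/- Let 2 < p < ∞ and p' = p/(p−1). Suppose C > 0 is such that for every n ∈ ℕ and all real-valued functions f_1,…,f_n on {-1,1}^n one has ‖Σ_{i=1}^n Δ^{-1/2} D_i f_i‖_{L^p} ≤ C · (E_δ‖Σ_{i=1}^n δ_i f_i‖_{L^p}^p)^{1/p}. Then there is a constant C' depending only on C and p such that for every n ∈ ℕ and every real-valued g on {-1,1}^n with E_ε g = 0, one has ‖(Σ_{i=1}^n (D_i g)²)^{1/2}‖_{L^{p'}} ≤ C' · ‖Δ^{1/2} g‖_{L^{p'}}, where L^r-norms are taken with respect to the uniform probability measure on {-1,1}^n. -/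

import Mathlib

open scoped BigOperators
open Finset

noncomputable section

/-- The ±1 value of a Boolean coordinate. -/
def rad (b : Bool) : ℝ := if b then 1 else -1

/-- Expectation over the uniform measure on the discrete cube `{-1,1}^n`
(points encoded as `Fin n → Bool`). -/
def cubeAvg {n : ℕ} {X : Type*} [AddCommGroup X] [Module ℝ X]
    (f : (Fin n → Bool) → X) : X :=
  ((2 ^ n : ℝ)⁻¹) • ∑ ε : Fin n → Bool, f ε

/-- Walsh character `w_A(ε) = ∏_{i ∈ A} ε_i`. -/
def walshChar {n : ℕ} (A : Finset (Fin n)) (ε : Fin n → Bool) : ℝ :=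
  ∏ i ∈ A, rad (ε i)

/-- Walsh coefficient `f̂(A) = E_ε [f(ε) w_A(ε)]`. -/
def wcoef {n : ℕ} {X : Type*} [AddCommGroup X] [Module ℝ X]
    (f : (Fin n → Bool) → X) (A : Finset (Fin n)) : X :=
  cubeAvg (fun ε => walshChar A ε • f ε)

/-- Flip the `j`-th coordinate. -/
def flipCoord {n : ℕ} (j : Fin n) (ε : Fin n → Bool) : Fin n → Bool :=
  Function.update ε j (!(ε j))

/-- Discrete derivative `D_j f(ε) = (f(ε) - f(σ_j ε))/2`. -/
def Dop {n : ℕ} {X : Type*} [AddCommGroup X] [Module ℝ X]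
    (j : Fin n) (f : (Fin n → Bool) → X) : (Fin n → Bool) → X :=
  fun ε => (2 : ℝ)⁻¹ • (f ε - f (flipCoord j ε))

/-- Heat semigroup `P_t f = Σ_A e^{-t|A|} f̂(A) w_A`. -/
def heatOp {n : ℕ} {X : Type*} [AddCommGroup X] [Module ℝ X]
    (t : ℝ) (f : (Fin n → Bool) → X) : (Fin n → Bool) → X :=
  fun ε => ∑ A : Finset (Fin n), (Real.exp (-t * A.card) * walshChar A ε) • wcoef f A

/-- Fractional power of the Laplacian on mean-zero parts:
`Δ^a f = Σ_{A ≠ ∅} |A|^a f̂(A) w_A`. -/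
def lapPow {n : ℕ} {X : Type*} [AddCommGroup X] [Module ℝ X]
    (a : ℝ) (f : (Fin n → Bool) → X) : (Fin n → Bool) → X :=
  fun ε => ∑ A ∈ Finset.univ.filter (fun A : Finset (Fin n) => A ≠ ∅),
    (((A.card : ℝ)) ^ a * walshChar A ε) • wcoef f A

/-- `X` has cotype `q` with constant `K`. -/
def HasCotypeConst (X : Type*) [NormedAddCommGroup X] [NormedSpace ℝ X] (q K : ℝ) : Prop :=
  ∀ m : ℕ, ∀ x : Fin m → X,
    (∑ j, ‖x j‖ ^ q) ^ (1 / q) ≤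
      K * (cubeAvg (fun δ : Fin m → Bool => ‖∑ j, rad (δ j) • x j‖ ^ (2 : ℝ))) ^ (1 / 2 : ℝ)

/-- `X` has type `s` with constant `T`. -/
def HasTypeConst (X : Type*) [NormedAddCommGroup X] [NormedSpace ℝ X] (s T : ℝ) : Prop :=
  ∀ m : ℕ, ∀ x : Fin m → X,
    (cubeAvg (fun δ : Fin m → Bool => ‖∑ j, rad (δ j) • x j‖ ^ (2 : ℝ))) ^ (1 / 2 : ℝ) ≤
      T * (∑ j, ‖x j‖ ^ s) ^ (1 / s)

lemma cubeAvg_real {n : ℕ} (f : (Fin n → Bool) → ℝ) :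
    cubeAvg f = (2 ^ n : ℝ)⁻¹ * ∑ ε, f ε := rfl

lemma cubeAvg_mono {n : ℕ} {f g : (Fin n → Bool) → ℝ} (h : ∀ ε, f ε ≤ g ε) :
    cubeAvg f ≤ cubeAvg g := by
  rw [cubeAvg_real, cubeAvg_real]
  exact mul_le_mul_of_nonneg_left (Finset.sum_le_sum fun ε _ => h ε) (by positivity)

lemma cubeAvg_nonneg {n : ℕ} {f : (Fin n → Bool) → ℝ} (h : ∀ ε, 0 ≤ f ε) :
    0 ≤ cubeAvg f := by
  rw [cubeAvg_real]
  exact mul_nonneg (by positivity) (Finset.sum_nonneg fun ε _ => h ε)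

lemma cubeAvg_const_mul {n : ℕ} (c : ℝ) (f : (Fin n → Bool) → ℝ) :
    cubeAvg (fun ε => c * f ε) = c * cubeAvg f := by
  rw [cubeAvg_real, cubeAvg_real, ← Finset.mul_sum]; ring

lemma cubeAvg_sum {n : ℕ} {ι : Type*} (s : Finset ι) (f : ι → (Fin n → Bool) → ℝ) :
    cubeAvg (fun ε => ∑ i ∈ s, f i ε) = ∑ i ∈ s, cubeAvg (f i) := by
  simp only [cubeAvg_real]
  rw [Finset.sum_comm, Finset.mul_sum]

lemma cubeAvg_comm {n m : ℕ} (f : (Fin n → Bool) → (Fin m → Bool) → ℝ) :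
    cubeAvg (fun δ => cubeAvg (fun ε => f δ ε)) = cubeAvg (fun ε => cubeAvg (fun δ => f δ ε)) := by
  simp only [cubeAvg_real]
  rw [← Finset.mul_sum, ← Finset.mul_sum, Finset.sum_comm]; ring

lemma rad_mul_self (b : Bool) : rad b * rad b = 1 := by cases b <;> simp [rad]

lemma walsh_eq_prod {n : ℕ} (A : Finset (Fin n)) (ε : Fin n → Bool) :
    walshChar A ε = ∏ i, if i ∈ A then rad (ε i) else 1 := by
  simp [walshChar, Finset.prod_ite_mem]

lemma walsh_orth {n : ℕ} (A B : Finset (Fin n)) :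
    cubeAvg (fun ε => walshChar A ε * walshChar B ε) = if A = B then 1 else 0 := by
  rw [cubeAvg_real]
  split_ifs with h
  · subst h
    have : ∀ ε : Fin n → Bool, walshChar A ε * walshChar A ε = 1 := by
      intro ε
      simp [walshChar, ← Finset.prod_mul_distrib, rad_mul_self]
    simp [this]
  · have h2 : ∃ i, ¬ (i ∈ A ↔ i ∈ B) := by
      by_contra hc
      push Not at hc
      exact h (Finset.ext hc)
    obtain ⟨i, hi⟩ := h2
    have : ∑ ε : Fin n → Bool, walshChar A ε * walshChar B ε
        = ∏ i, ∑ b : Bool, (if i ∈ A then rad b else 1) * (if i ∈ B then rad b else 1) := by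
      rw [Fintype.prod_sum]
      refine Finset.sum_congr rfl fun ε _ => ?_
      rw [walsh_eq_prod, walsh_eq_prod, ← Finset.prod_mul_distrib]
    rw [this, Finset.prod_eq_zero (Finset.mem_univ i), mul_zero]
    by_cases hA : i ∈ A <;> by_cases hB : i ∈ B <;> simp_all [rad]

lemma walsh_compl {n : ℕ} (ε η : Fin n → Bool) :
    ∑ A : Finset (Fin n), walshChar A ε * walshChar A η = if ε = η then 2 ^ n else 0 := by
  have : ∑ A : Finset (Fin n), walshChar A ε * walshChar A η
      = ∏ i, (1 + rad (ε i) * rad (η i)) := by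
    rw [Finset.prod_one_add, Finset.powerset_univ]
    simp [walshChar, ← Finset.prod_mul_distrib]
  rw [this]
  split_ifs with h
  · subst h
    simp [rad_mul_self]; norm_num
  · obtain ⟨i, hi⟩ := Function.ne_iff.mp h
    apply Finset.prod_eq_zero (Finset.mem_univ i)
    revert hi
    cases ε i <;> cases η i <;> simp [rad]

lemma parseval {n : ℕ} (u v : (Fin n → Bool) → ℝ) :
    ∑ A, wcoef u A * wcoef v A = cubeAvg (fun ε => u ε * v ε) := by
  have h1 : ∀ A : Finset (Fin n), wcoef u A * wcoef v A
      = (2 ^ n : ℝ)⁻¹ * (2 ^ n : ℝ)⁻¹ *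
        ∑ ε, ∑ η, u ε * v η * (walshChar A ε * walshChar A η) := by
    intro A
    simp only [wcoef, cubeAvg_real, smul_eq_mul]
    rw [mul_mul_mul_comm, Finset.sum_mul_sum]
    congr 1
    refine Finset.sum_congr rfl fun ε _ => Finset.sum_congr rfl fun η _ => by ring
  simp only [h1]
  rw [← Finset.mul_sum, Finset.sum_comm]
  have h2 : ∀ ε : Fin n → Bool, ∑ A : Finset (Fin n), ∑ η, u ε * v η * (walshChar A ε * walshChar A η)
      = 2 ^ n * (u ε * v ε) := by
    intro ε
    rw [Finset.sum_comm]
    simp only [← Finset.mul_sum, walsh_compl]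
    simp; ring
  simp only [h2]
  rw [← Finset.mul_sum, cubeAvg_real, mul_assoc, inv_mul_cancel_left₀ (by positivity)]

lemma flip_invol {n : ℕ} (i : Fin n) : Function.Involutive (flipCoord i) := by
  intro ε
  simp [flipCoord]

lemma Dop_adj {n : ℕ} (i : Fin n) (f g : (Fin n → Bool) → ℝ) :
    cubeAvg (fun ε => Dop i f ε * g ε) = cubeAvg (fun ε => f ε * Dop i g ε) := by
  have h : ∑ ε, f (flipCoord i ε) * g ε = ∑ ε, f ε * g (flipCoord i ε) := by
    rw [← Equiv.sum_comp (flip_invol i).toPerm]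
    refine Finset.sum_congr rfl fun ε _ => ?_
    simp [flip_invol i ε]
  rw [cubeAvg_real, cubeAvg_real]
  congr 1
  simp only [Dop, smul_eq_mul, mul_sub, sub_mul, Finset.sum_sub_distrib]
  congr 1
  · exact Finset.sum_congr rfl fun ε _ => by ring
  · simp only [mul_assoc, ← Finset.mul_sum, h, mul_left_comm _ (2:ℝ)⁻¹]

lemma wcoef_lapPow {n : ℕ} (a : ℝ) (g : (Fin n → Bool) → ℝ) (A : Finset (Fin n)) (hA : A ≠ ∅) :
    wcoef (lapPow a g) A = (A.card : ℝ) ^ a * wcoef g A := by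
  have : ∀ ε : Fin n → Bool, walshChar A ε • lapPow a g ε =
      ∑ B ∈ Finset.univ.filter (fun B : Finset (Fin n) => B ≠ ∅),
        ((B.card : ℝ) ^ a * wcoef g B) * (walshChar A ε * walshChar B ε) := by
    intro ε
    simp only [lapPow, smul_eq_mul, Finset.mul_sum]
    refine Finset.sum_congr rfl fun B _ => by ring
  rw [wcoef]
  simp only [this]
  rw [cubeAvg_sum]
  simp only [cubeAvg_const_mul, walsh_orth]
  simp [hA]

lemma wcoef_lapPow_empty {n : ℕ} (a : ℝ) (g : (Fin n → Bool) → ℝ) :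
    wcoef (lapPow a g) ∅ = 0 := by
  have : ∀ ε : Fin n → Bool, walshChar ∅ ε • lapPow a g ε =
      ∑ B ∈ Finset.univ.filter (fun B : Finset (Fin n) => B ≠ ∅),
        ((B.card : ℝ) ^ a * wcoef g B) * (walshChar ∅ ε * walshChar B ε) := by
    intro ε
    simp only [lapPow, smul_eq_mul, Finset.mul_sum]
    refine Finset.sum_congr rfl fun B _ => by ring
  rw [wcoef]
  simp only [this]
  rw [cubeAvg_sum]
  simp only [cubeAvg_const_mul, walsh_orth]
  simp

lemma pairing {n : ℕ} (i : Fin n) (f g : (Fin n → Bool) → ℝ) (hg : cubeAvg g = 0) :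
    cubeAvg (fun ε => lapPow (-(1 / 2)) (Dop i f) ε * lapPow (1 / 2) g ε)
      = cubeAvg (fun ε => f ε * Dop i g ε) := by
  rw [← Dop_adj, ← parseval, ← parseval]
  refine Finset.sum_congr rfl fun A _ => ?_
  by_cases hA : A = ∅
  · subst hA
    have : wcoef g ∅ = 0 := by simpa [wcoef, walshChar] using hg
    rw [wcoef_lapPow_empty, this]; simp
  · rw [wcoef_lapPow _ _ _ hA, wcoef_lapPow _ _ _ hA]
    have hc : (0:ℝ) < A.card := by
      exact_mod_cast Finset.card_pos.mpr (Finset.nonempty_iff_ne_empty.mpr hA)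
    have : (A.card : ℝ) ^ (-(1/2) : ℝ) * (A.card : ℝ) ^ (1/2 : ℝ) = 1 := by
      rw [← Real.rpow_add hc]; norm_num
    linear_combination (wcoef (Dop i f) A * wcoef g A) * this

lemma cube_holder {n : ℕ} {p q : ℝ} (hpq : p.HolderConjugate q) (u v : (Fin n → Bool) → ℝ) :
    cubeAvg (fun ε => u ε * v ε) ≤
      (cubeAvg (fun ε => |u ε| ^ p)) ^ (1 / p) * (cubeAvg (fun ε => |v ε| ^ q)) ^ (1 / q) := by
  simp only [cubeAvg_real]
  have hc : (0:ℝ) < (2 ^ n)⁻¹ := by positivity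
  have hs : ∀ (w : (Fin n → Bool) → ℝ) (r : ℝ), 0 ≤ ∑ ε, |w ε| ^ r :=
    fun w r => Finset.sum_nonneg fun ε _ => by positivity
  rw [Real.mul_rpow hc.le (hs _ _), Real.mul_rpow hc.le (hs _ _), mul_mul_mul_comm,
    ← Real.rpow_add hc, one_div, one_div, hpq.inv_add_inv_eq_one, Real.rpow_one]
  have := Real.inner_le_Lp_mul_Lq Finset.univ u v hpq
  rw [one_div, one_div] at this
  exact mul_le_mul_of_nonneg_left this hc.le

lemma exp_avg {n : ℕ} (a : Fin n → ℝ) :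
    cubeAvg (fun δ : Fin n → Bool => Real.exp (∑ i, rad (δ i) * a i)) ≤
      Real.exp ((∑ i, a i ^ 2) / 2) := by
  have h : cubeAvg (fun δ : Fin n → Bool => Real.exp (∑ i, rad (δ i) * a i))
      = ∏ i, Real.cosh (a i) := by
    rw [cubeAvg_real]
    simp only [Real.exp_sum]
    rw [← Fintype.prod_sum (fun i (b : Bool) => Real.exp (rad b * a i))]
    have : ∀ i, ∑ b : Bool, Real.exp (rad b * a i) = 2 * Real.cosh (a i) := by
      intro i
      simp [rad, Real.cosh_eq]
      ring
    simp only [this, Finset.prod_mul_distrib]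
    simp
  rw [h, Finset.sum_div, Real.exp_sum]
  exact Finset.prod_le_prod (fun i _ => (Real.cosh_pos _).le)
    fun i _ => Real.cosh_le_exp_half_sq _

lemma khinchin_one {n : ℕ} {p : ℝ} (hp : 0 < p) (a : Fin n → ℝ) (ha : ∑ i, a i ^ 2 = 1) :
    cubeAvg (fun δ : Fin n → Bool => |∑ i, rad (δ i) * a i| ^ p) ≤ 2 * Real.exp (p ^ 2 / 2) := by
  have key : ∀ x : ℝ, |x| ^ p ≤ Real.exp (p * x) + Real.exp (-p * x) := by
    intro x
    have h1 : |x| ≤ Real.exp |x| := by linarith [Real.add_one_le_exp |x|]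
    have h2 : |x| ^ p ≤ Real.exp (p * |x|) := by
      calc |x| ^ p ≤ (Real.exp |x|) ^ p := Real.rpow_le_rpow (abs_nonneg _) h1 hp.le
        _ = Real.exp (p * |x|) := by rw [← Real.exp_mul, mul_comm]
    rcases abs_cases x with ⟨h, _⟩ | ⟨h, _⟩
    · rw [h] at h2 ⊢
      linarith [Real.exp_pos (-p * x)]
    · rw [h] at h2 ⊢
      have : p * -x = -p * x := by ring
      rw [this] at h2
      linarith [Real.exp_pos (p * x)]
  have hb : ∀ c : ℝ, c ^ 2 = p ^ 2 →
      cubeAvg (fun δ : Fin n → Bool => Real.exp (c * ∑ i, rad (δ i) * a i))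
        ≤ Real.exp (p ^ 2 / 2) := by
    intro c hc
    have := exp_avg (fun i => c * a i)
    simp only [mul_pow, ← Finset.mul_sum, ha, hc, mul_one] at this
    refine le_trans (le_of_eq ?_) this
    congr 1; ext δ
    rw [Finset.mul_sum]
    congr 1
    exact Finset.sum_congr rfl fun i _ => by ring
  refine (cubeAvg_mono fun δ => key _).trans ?_
  have hadd : cubeAvg (fun δ : Fin n → Bool => Real.exp (p * ∑ i, rad (δ i) * a i) +
      Real.exp (-p * ∑ i, rad (δ i) * a i)) =
      cubeAvg (fun δ : Fin n → Bool => Real.exp (p * ∑ i, rad (δ i) * a i)) +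
      cubeAvg (fun δ : Fin n → Bool => Real.exp (-p * ∑ i, rad (δ i) * a i)) := by
    simp only [cubeAvg_real, Finset.sum_add_distrib, mul_add]
  rw [hadd]
  linarith [hb p rfl, hb (-p) (by ring)]

lemma khinchin {n : ℕ} {p : ℝ} (hp : 0 < p) (a : Fin n → ℝ) :
    cubeAvg (fun δ : Fin n → Bool => |∑ i, rad (δ i) * a i| ^ p) ≤
      2 * Real.exp (p ^ 2 / 2) * (Real.sqrt (∑ i, a i ^ 2)) ^ p := by
  have hs0 : 0 ≤ ∑ i, a i ^ 2 := Finset.sum_nonneg fun i _ => sq_nonneg _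
  rcases hs0.eq_or_lt with h | h
  · have ha : ∀ i, a i = 0 := by
      intro i
      have := (Finset.sum_eq_zero_iff_of_nonneg (fun i _ => sq_nonneg (a i))).mp h.symm i
        (Finset.mem_univ i)
      exact pow_eq_zero_iff (two_ne_zero) |>.mp this
    simp [ha, Real.zero_rpow hp.ne', cubeAvg_real]
  · set s := Real.sqrt (∑ i, a i ^ 2) with hs
    have hsp : 0 < s := Real.sqrt_pos.mpr h
    have hsq : s ^ 2 = ∑ i, a i ^ 2 := Real.sq_sqrt hs0
    have h1 : ∑ i, (a i / s) ^ 2 = 1 := by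
      simp only [div_pow, ← Finset.sum_div, hsq]
      exact div_self h.ne'
    have := khinchin_one hp _ h1
    have e : ∀ δ : Fin n → Bool, |∑ i, rad (δ i) * a i| ^ p =
        s ^ p * |∑ i, rad (δ i) * (a i / s)| ^ p := by
      intro δ
      rw [← Real.mul_rpow hsp.le (abs_nonneg _), ← abs_of_pos hsp, ← abs_mul, abs_of_pos hsp,
        Finset.mul_sum]
      congr 2
      exact Finset.sum_congr rfl fun i _ => by field_simp
    simp only [e, cubeAvg_const_mul]
    rw [mul_comm]
    gcongr

/-- if the Riesz-type estimate `‖Σ Δ^{-1/2}D_i f_i‖_p ≤ C (E_δ‖Σ δ_i f_i‖_p^p)^{1/p}`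
held for some `p > 2`, then the dual gradient estimate
`‖|∇g|_{ℓ²}‖_{p'} ≤ C' ‖Δ^{1/2} g‖_{p'}` would hold for `p' = p/(p-1)`. -/
theorem duality_implication (p : ℝ) (hp1 : 2 < p) (C : ℝ) (hC : 0 < C)
    (H : ∀ (n : ℕ) (f : Fin n → (Fin n → Bool) → ℝ),
      (cubeAvg (fun ε => |∑ i, lapPow (-(1 / 2)) (Dop i (f i)) ε| ^ p)) ^ (1 / p) ≤
        C * (cubeAvg (fun δ : Fin n → Bool =>
          cubeAvg (fun ε => |∑ i, rad (δ i) * f i ε| ^ p))) ^ (1 / p)) :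
    ∃ C' : ℝ, ∀ (n : ℕ) (g : (Fin n → Bool) → ℝ), cubeAvg g = 0 →
      (cubeAvg (fun ε =>
          (Real.sqrt (∑ i, (Dop i g ε) ^ 2)) ^ (p / (p - 1)))) ^ (1 / (p / (p - 1))) ≤
        C' * (cubeAvg (fun ε =>
          |lapPow (1 / 2) g ε| ^ (p / (p - 1)))) ^ (1 / (p / (p - 1))) := by
  have hp0 : 0 < p := by linarith
  have hpq : p.HolderConjugate (p / (p - 1)) := Real.HolderConjugate.conjExponent (by linarith)
  set q := p / (p - 1) with hq
  have hq0 : 0 < q := hpq.symm.pos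
  have hqp : (q - 1) * p = q := by
    rw [hq]; field_simp [show p - 1 ≠ 0 by linarith]; ring
  refine ⟨C * (2 * Real.exp (p ^ 2 / 2)) ^ (1 / p), fun n g hg => ?_⟩
  set K := 2 * Real.exp (p ^ 2 / 2) with hK
  have hK0 : 0 < K := by positivity
  set h : (Fin n → Bool) → ℝ := fun ε => Real.sqrt (∑ i, (Dop i g ε) ^ 2) with hh
  have hsq : ∀ ε, ∑ i, (Dop i g ε) ^ 2 = h ε ^ 2 := fun ε =>
    (Real.sq_sqrt (Finset.sum_nonneg fun i _ => sq_nonneg _)).symm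
  have hn : ∀ ε, 0 ≤ h ε := fun ε => Real.sqrt_nonneg _
  set f : Fin n → (Fin n → Bool) → ℝ := fun i ε => Dop i g ε * h ε ^ (q - 2) with hf
  -- the dual pairing is the q-th power of the gradient
  have e1 : ∀ ε, ∑ i, f i ε * Dop i g ε = h ε ^ q := by
    intro ε
    have : ∑ i, f i ε * Dop i g ε = h ε ^ 2 * h ε ^ (q - 2) := by
      rw [← hsq, Finset.sum_mul]
      exact Finset.sum_congr rfl fun i _ => by simp only [hf]; ring
    rw [this]
    rcases (hn ε).eq_or_lt with h0 | h0
    · rw [← h0, Real.zero_rpow hq0.ne']; simp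
    · rw [← Real.rpow_natCast, ← Real.rpow_add h0]; congr 1; push_cast; ring
  have e2 : ∀ ε, (Real.sqrt (∑ i, f i ε ^ 2)) ^ p = h ε ^ q := by
    intro ε
    have : ∑ i, f i ε ^ 2 = (h ε * h ε ^ (q - 2)) ^ 2 := by
      rw [mul_pow, ← hsq, Finset.sum_mul]
      exact Finset.sum_congr rfl fun i _ => by simp only [hf]; ring
    rw [this, Real.sqrt_sq (mul_nonneg (hn ε) (Real.rpow_nonneg (hn ε) _))]
    rcases (hn ε).eq_or_lt with h0 | h0
    · rw [← h0, Real.zero_rpow hq0.ne']; simp [Real.zero_rpow hp0.ne']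
    · have : h ε * h ε ^ (q - 2) = h ε ^ (q - 1) := by
        nth_rewrite 1 [← Real.rpow_one (h ε)]
        rw [← Real.rpow_add h0]; congr 1; ring
      rw [this, ← Real.rpow_mul h0.le, hqp]
  set S := cubeAvg (fun ε => h ε ^ q) with hS
  have hS0 : 0 ≤ S := cubeAvg_nonneg fun ε => Real.rpow_nonneg (hn ε) _
  set M := (cubeAvg (fun ε => |lapPow (1 / 2) g ε| ^ q)) ^ (1 / q) with hM
  have hM0 : 0 ≤ M := Real.rpow_nonneg (cubeAvg_nonneg fun ε => by positivity) _
  have e3 : S = cubeAvg (fun ε => (∑ i, lapPow (-(1 / 2)) (Dop i (f i)) ε) * lapPow (1 / 2) g ε) := by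
    simp only [Finset.sum_mul]
    rw [cubeAvg_sum]
    simp only [pairing _ _ _ hg]
    rw [← cubeAvg_sum]
    simp only [e1, hS]
  have e4 : cubeAvg (fun δ : Fin n → Bool => cubeAvg (fun ε => |∑ i, rad (δ i) * f i ε| ^ p))
      ≤ K * S := by
    rw [cubeAvg_comm, hS, ← cubeAvg_const_mul]
    refine cubeAvg_mono fun ε => ?_
    rw [← e2]
    exact khinchin hp0 _
  have e5 : S ≤ C * (K * S) ^ (1 / p) * M := by
    rw [e3]
    refine (cube_holder hpq _ _).trans ?_
    rw [← e3]
    refine mul_le_mul_of_nonneg_right ((H n f).trans ?_) hM0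
    refine mul_le_mul_of_nonneg_left (Real.rpow_le_rpow ?_ e4 (by positivity)) hC.le
    exact cubeAvg_nonneg fun δ => cubeAvg_nonneg fun ε => by positivity
  rcases hS0.eq_or_lt with h0 | h0
  · rw [← h0, Real.zero_rpow (by positivity)]
    positivity
  · rw [Real.mul_rpow hK0.le hS0] at e5
    have hsplit : S = S ^ (1 / q) * S ^ (1 / p) := by
      rw [← Real.rpow_add h0, one_div, one_div, add_comm, hpq.inv_add_inv_eq_one, Real.rpow_one]
    have hSp : 0 < S ^ (1 / p) := Real.rpow_pos_of_pos h0 _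
    refine le_of_mul_le_mul_right ?_ hSp
    rw [← hsplit]
    linarith [e5]

end
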